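/- arXiv:1412.8058 — 2 statements merged into one kernel-verified Lean document; each statement's English description precedes it below -/
import Mathlib

section
/- Let A be a commutative k-algebra. There is a bijection between algebra homomorphisms f : A → A^ℕ (into the λ-Hurwitz series algebra) satisfying ε_A ∘ f = id_A and δ_A ∘ f = f^ℕ ∘ f, and λ-derivations on A; the bijection sends such an f to the map a ↦ f(a)(1), with inverse sending d to a ↦ (n ↦ d^{(n)}(a)). -/
open Finset

/-- The `λ`-Hurwitz product over a `k`-module `M` with respect to a
multiplication `mul`. -/
def hmulG {k M : Type*} [CommRing k] [AddCommMonoid M] [Module k M]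
    (lam : k) (mul : M → M → M) (f g : ℕ → M) : ℕ → M :=
  fun n => ∑ i ∈ range (n + 1), ∑ j ∈ range (n - i + 1),
    (n.choose i * (n - i).choose j) • (lam ^ i • mul (f (n - j)) (g (i + j)))

/-- The `λ`-Hurwitz product on `A^ℕ` for a commutative `k`-algebra `A`. -/
def hmul {k A : Type*} [CommRing k] [CommRing A] [Algebra k A] (lam : k)
    (f g : ℕ → A) : ℕ → A :=
  hmulG lam (· * ·) f g

/-- The identity of the `λ`-Hurwitz series algebra. -/
def hone {A : Type*} [CommRing A] : ℕ → A := fun n => if n = 0 then 1 else 0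

/-- The shift operator `∂_A`. -/
def hshift {A : Type*} (f : ℕ → A) : ℕ → A := fun n => f (n + 1)

/-- The comultiplication-type map `δ_A`. -/
def hdel {M : Type*} (f : ℕ → M) : ℕ → ℕ → M := fun m n => f (m + n)

open scoped TensorProduct in
/-- The higher Leibniz rule for a `λ`-derivation: its iterates turn products into `λ`-Hurwitz
products. -/
theorem iterate_mul_eq_hmul {k A : Type*} [CommRing k] [CommRing A] [Algebra k A] (lam : k)
    (d : A →ₗ[k] A) (hd : ∀ a b : A, d (a * b) = d a * b + a * d b + lam • (d a * d b))
    (a b : A) (n : ℕ) :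
    d^[n] (a * b) = hmul lam (fun m => d^[m] a) (fun m => d^[m] b) n := by
  set X : Module.End k (A ⊗[k] A) := d.rTensor A with hX
  set Y : Module.End k (A ⊗[k] A) := d.lTensor A with hY
  have hYX : Commute Y X := by
    change Y * X = X * Y
    ext x y
    simp [hX, hY]
  have hcomm : Commute (lam • (X * Y)) (Y + X) :=
    ((hYX.symm.mul_left (Commute.refl Y)).add_right
      ((Commute.refl X).mul_left hYX)).smul_left lam
  have hpow : ∀ p q : ℕ, (X ^ p * Y ^ q) (a ⊗ₜ[k] b) = (d^[p] a) ⊗ₜ[k] (d^[q] b) := by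
    intro p q
    rw [hX, hY, LinearMap.rTensor_pow, LinearMap.lTensor_pow]
    simp [Module.End.pow_apply]
  have hsemi : ∀ t, LinearMap.mul' k A ((lam • (X * Y) + (Y + X)) t) =
      d (LinearMap.mul' k A t) := by
    intro t
    induction t with
    | zero => simp
    | add x y hx hy => rw [map_add, map_add, hx, hy, map_add, map_add]
    | tmul x y =>
      simp only [hX, hY, LinearMap.add_apply, LinearMap.smul_apply, Module.End.mul_apply,
        LinearMap.lTensor_tmul, LinearMap.rTensor_tmul, map_add, map_smul,
        LinearMap.mul'_apply, hd]
      ring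
  have hiter : LinearMap.mul' k A (((lam • (X * Y) + (Y + X)) ^ n) (a ⊗ₜ[k] b)) =
      d^[n] (a * b) := by
    rw [Module.End.pow_apply, (Function.Semiconj.iterate_right hsemi n) (a ⊗ₜ[k] b),
      LinearMap.mul'_apply]
  have hterm : ∀ i ∈ range (n + 1), ∀ j ∈ range (n - i + 1),
      (lam • (X * Y)) ^ i * (Y ^ j * X ^ (n - i - j) * ((n - i).choose j : Module.End k _)) *
        (n.choose i : Module.End k _) =
      (n.choose i * (n - i).choose j) • (lam ^ i • (X ^ (n - j) * Y ^ (i + j))) := by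
    intro i hi j hj
    simp only [mem_range] at hi hj
    have hexp : n - j = i + (n - i - j) := by omega
    have hmono : (X * Y) ^ i * (Y ^ j * X ^ (n - i - j)) = X ^ (n - j) * Y ^ (i + j) := by
      rw [hYX.symm.mul_pow, hexp, pow_add, pow_add, ← mul_assoc, mul_assoc (X ^ i),
        mul_assoc (X ^ i), ← pow_add, (hYX.pow_pow (i + j) (n - i - j)).eq, pow_add,
        mul_assoc]
    rw [← mul_assoc, mul_assoc, smul_pow, smul_mul_assoc, hmono, ← Nat.cast_mul,
      mul_comm ((n - i).choose j), ← nsmul_eq_mul']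
  rw [← hiter, hcomm.add_pow]
  simp only [hYX.add_pow, mul_sum, sum_mul]
  rw [sum_congr rfl fun i hi => sum_congr rfl (hterm i hi)]
  simp only [LinearMap.sum_apply, LinearMap.smul_apply, hpow, map_sum, map_nsmul, map_smul,
    LinearMap.mul'_apply, hmul, hmulG]

/-- Bijection between algebra homomorphisms `f : A → A^ℕ` with
`ε_A ∘ f = id` and `δ_A ∘ f = f^ℕ ∘ f`, and `λ`-derivations on `A`; it
sends `f` to `a ↦ f a 1`, with inverse `d ↦ (a ↦ n ↦ d^{(n)} a)`. -/
theorem costructure_derivation_bijection {k A : Type*} [CommRing k]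
    [CommRing A] [Algebra k A] (lam : k) :
    ∃ (Φ : {f : A → ℕ → A //
              (∀ a b : A, f (a * b) = hmul lam (f a) (f b)) ∧
              (∀ a b : A, f (a + b) = f a + f b) ∧
              (∀ (c : k) (a : A), f (c • a) = c • f a) ∧
              f 1 = hone ∧
              (∀ a : A, f a 0 = a) ∧
              (∀ a : A, hdel (f a) = fun m => f (f a m))} →
           {d : A → A //
              (∀ a b : A, d (a + b) = d a + d b) ∧
              (∀ (c : k) (a : A), d (c • a) = c • d a) ∧
              (∀ a b : A, d (a * b) = d a * b + a * d b + lam • (d a * d b)) ∧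
              d 1 = 0})
      (Ψ : {d : A → A //
              (∀ a b : A, d (a + b) = d a + d b) ∧
              (∀ (c : k) (a : A), d (c • a) = c • d a) ∧
              (∀ a b : A, d (a * b) = d a * b + a * d b + lam • (d a * d b)) ∧
              d 1 = 0} →
           {f : A → ℕ → A //
              (∀ a b : A, f (a * b) = hmul lam (f a) (f b)) ∧
              (∀ a b : A, f (a + b) = f a + f b) ∧
              (∀ (c : k) (a : A), f (c • a) = c • f a) ∧
              f 1 = hone ∧
              (∀ a : A, f a 0 = a) ∧
              (∀ a : A, hdel (f a) = fun m => f (f a m))}),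
      (∀ f, (Φ f).1 = fun a => f.1 a 1) ∧
      (∀ d, (Ψ d).1 = fun a n => (d.1)^[n] a) ∧
      Function.LeftInverse Ψ Φ ∧ Function.RightInverse Ψ Φ := by
  refine ⟨fun f => ⟨fun a => f.1 a 1, ?_, ?_, ?_, ?_⟩,
    fun d => ⟨fun a n => (d.1)^[n] a, ?_, ?_, ?_, ?_, ?_, ?_⟩,
    fun _ => rfl, fun _ => rfl, ?_, ?_⟩
  · intro a b
    simp [f.2.2.1]
  · intro c a
    simp [f.2.2.2.1]
  · intro a b
    obtain ⟨f, hmul_f, -, -, -, hf0, -⟩ := f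
    simp [hmul_f, hmul, hmulG, sum_range_succ, hf0]
  · simp [f.2.2.2.2.1, hone]
  · obtain ⟨d, hadd, hsmul, hleib, -⟩ := d
    intro a b
    funext n
    exact iterate_mul_eq_hmul lam ⟨⟨d, hadd⟩, hsmul⟩ hleib a b n
  · obtain ⟨d, hadd, -⟩ := d
    intro a b
    funext n
    exact iterate_map_add (⟨d, hadd⟩ : AddHom A A) n a b
  · obtain ⟨d, -, hsmul, -⟩ := d
    intro c a
    funext n
    exact (Function.Semiconj.iterate_right (fun x => (hsmul c x).symm) n a).symm
  · obtain ⟨d, hadd, -, -, hd1⟩ := d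
    have hd0 : d 0 = 0 := by simpa using hadd 0 0
    funext n
    cases n with
    | zero => simp [hone]
    | succ n => simp [hone, hd1, Function.iterate_fixed hd0]
  · intro a
    rfl
  · intro a
    funext m n
    simp only [hdel]
    rw [add_comm, Function.iterate_add_apply]
  · rintro ⟨f, -, -, -, -, hf0, hfdel⟩
    refine Subtype.ext (funext fun a => funext fun n => ?_)
    change (fun x => f x 1)^[n] a = f a n
    induction n with
    | zero => exact (hf0 a).symm
    | succ n ih =>
      rw [Function.iterate_succ_apply', ih]
      exact (congrFun (congrFun (hfdel a) n) 1).symm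
  · intro d
    rfl
end

section
/- Let (A,d) be a commutative k-algebra with a λ-derivation d. Define d̄ on Ш(A) = ⊕_{n≥0} A^{⊗(n+1)} by d̄(x_0) = d(x_0) and, for n ≥ 1, d̄(x_0⊗x_1⊗⋯⊗x_n) = d(x_0)⊗x_1⊗⋯⊗x_n + x_0x_1⊗x_2⊗⋯⊗x_n + λ d(x_0)x_1⊗x_2⊗⋯⊗x_n, extended linearly. Then d̄ is a λ-derivation on the mixable shuffle algebra (Ш(A),⋄), and together with P_A(x_0⊗⋯⊗x_n) = 1⊗x_0⊗⋯⊗x_n, the triple (Ш(A), d̄, P_A) is a differential Rota-Baxter algebra of weight λ, i.e., d̄ ∘ P_A = id. -/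
section MixableShuffle

variable {k A S : Type*} [CommRing k] [CommRing A] [Algebra k A] [AddCommGroup S] [Module k S]

theorem eq_const_of_fin_one {α : Type*} (x : Fin (0 + 1) → α) : x = fun _ => x 0 :=
  funext fun i => congrArg x (Fin.fin_one_eq_zero i)

/-- Two bilinear maps agree as soon as they agree on a spanning set. -/
theorem LinearMap.ext_on₂ {M : Type*} [AddCommGroup M] [Module k M] {G : Set S}
    (hG : Submodule.span k G = ⊤) {f g : S →ₗ[k] S →ₗ[k] M}
    (h : ∀ x ∈ G, ∀ y ∈ G, f x y = g x y) (x y : S) : f x y = g x y := by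
  have : f = g := LinearMap.ext_on hG fun x hx => LinearMap.ext_on hG fun y hy => h x hx y hy
  rw [this]

/-- If `S` is spanned by pure tensors, then it is spanned by the tensors of length one together
with the tensors obtained by prepending a letter. -/
theorem span_range_union_pre_eq_top (t : ∀ n : ℕ, MultilinearMap k (fun _ : Fin (n + 1) => A) S)
    (pre : A →ₗ[k] S →ₗ[k] S)
    (hpre : ∀ (a : A) (n : ℕ) (x : Fin (n + 1) → A), pre a (t n x) = t (n + 1) (Fin.cons a x))
    (hspan : Submodule.span k {s : S | ∃ n x, s = t n x} = ⊤) :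
    Submodule.span k ({s : S | ∃ a, s = t 0 fun _ => a} ∪ {s : S | ∃ a u, s = pre a u}) = ⊤ := by
  refine top_unique (hspan ▸ Submodule.span_mono ?_)
  rintro _ ⟨n, x, rfl⟩
  cases n with
  | zero => exact Or.inl ⟨x 0, congrArg _ (eq_const_of_fin_one x)⟩
  | succ n => exact Or.inr ⟨x 0, t n (Fin.tail x), by rw [hpre, Fin.cons_self_tail]⟩

/-- The mixable shuffle product is commutative. -/
theorem mixable_shuffle_comm (lam : k)
    (t : ∀ n : ℕ, MultilinearMap k (fun _ : Fin (n + 1) => A) S)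
    (pre : A →ₗ[k] S →ₗ[k] S)
    (hspan : Submodule.span k {s : S | ∃ n x, s = t n x} = ⊤)
    (mul : S →ₗ[k] S →ₗ[k] S)
    (h0l : ∀ (a : A) (n : ℕ) (b : Fin (n + 1) → A),
      mul (t 0 fun _ => a) (t n b) = t n (Function.update b 0 (a * b 0)))
    (h0r : ∀ (n : ℕ) (a : Fin (n + 1) → A) (b : A),
      mul (t n a) (t 0 fun _ => b) = t n (Function.update a 0 (a 0 * b)))
    (hrec : ∀ (m n : ℕ) (a : Fin (m + 2) → A) (b : Fin (n + 2) → A),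
      mul (t (m + 1) a) (t (n + 1) b) =
        pre (a 0 * b 0)
          (mul (t m (Fin.tail a)) (t (n + 1) (Fin.cons 1 (Fin.tail b)))
            + mul (t (m + 1) (Fin.cons 1 (Fin.tail a))) (t n (Fin.tail b))
            + lam • mul (t m (Fin.tail a)) (t n (Fin.tail b)))) (x y : S) :
    mul x y = mul y x := by
  have pure (m n : ℕ) (a : Fin (m + 1) → A) (b : Fin (n + 1) → A) :
      mul (t m a) (t n b) = mul (t n b) (t m a) := by
    induction hN : m + n using Nat.strong_induction_on generalizing m n with
    | _ N ih =>
      subst hN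
      match m, n with
      | 0, n => rw [eq_const_of_fin_one a, h0l, h0r, mul_comm]
      | m + 1, 0 => rw [eq_const_of_fin_one b, h0l, h0r, mul_comm]
      | m + 1, n + 1 =>
        rw [hrec, hrec, mul_comm (a 0), ih _ (by omega) m (n + 1) _ _ rfl,
          ih _ (by omega) (m + 1) n _ _ rfl, ih _ (by omega) m n _ _ rfl]
        congr 2
        abel
  refine LinearMap.ext_on₂ (f := mul) (g := mul.flip) hspan ?_ x y
  rintro _ ⟨m, a, rfl⟩ _ ⟨n, b, rfl⟩
  exact pure m n a b

/-- A linear operator satisfying the defining recursion of `d̄` is a `λ`-derivation of any product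
satisfying the defining recursion of the mixable shuffle product, where `ι` is the inclusion of
letters and `pre` prepends a letter. -/
theorem shuffle_lambda_derivation (lam : k) (ι : A →ₗ[k] S) (pre : A →ₗ[k] S →ₗ[k] S)
    (mul : S →ₗ[k] S →ₗ[k] S)
    (hspan : Submodule.span k ({s : S | ∃ a, s = ι a} ∪ {s : S | ∃ a u, s = pre a u}) = ⊤)
    (mul_ι_ι : ∀ a b, mul (ι a) (ι b) = ι (a * b))
    (mul_ι_pre : ∀ a b u, mul (ι a) (pre b u) = pre (a * b) u)
    (mul_pre_ι : ∀ a b u, mul (pre a u) (ι b) = pre (a * b) u)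
    (mul_pre_pre : ∀ a b u v, mul (pre a u) (pre b v) =
      pre (a * b) (mul u (pre 1 v) + mul (pre 1 u) v + lam • mul u v))
    (d : A →ₗ[k] A) (hd : ∀ x y : A, d (x * y) = d x * y + x * d y + lam • (d x * d y))
    (D : S →ₗ[k] S) (D_ι : ∀ a, D (ι a) = ι (d a))
    (D_pre : ∀ a u, D (pre a u) = pre (d a) u + mul (ι a) u + lam • mul (ι (d a)) u)
    (x y : S) :
    D (mul x y) = mul (D x) y + mul x (D y) + lam • mul (D x) (D y) := by
  have smul_mul_smul (a b : A) (u v : S) :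
      mul (mul (ι a) u) (mul (ι b) v) = mul (ι (a * b)) (mul u v) := by
    refine LinearMap.ext_on₂ (f := mul.compl₁₂ (mul (ι a)) (mul (ι b)))
      (g := mul.compr₂ (mul (ι (a * b)))) hspan ?_ u v
    rintro _ (⟨c, rfl⟩ | ⟨c, p, rfl⟩) _ (⟨e, rfl⟩ | ⟨e, q, rfl⟩) <;>
      simp only [LinearMap.compl₁₂_apply, LinearMap.compr₂_apply, mul_ι_ι, mul_ι_pre, mul_pre_ι,
        mul_pre_pre, mul_mul_mul_comm]
  have ι_mul_smul (a b : A) (v : S) : mul (ι a) (mul (ι b) v) = mul (ι (a * b)) v := by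
    refine LinearMap.congr_fun (f := mul (ι a) ∘ₗ mul (ι b)) (LinearMap.ext_on hspan ?_) v
    rintro _ (⟨c, rfl⟩ | ⟨c, p, rfl⟩) <;>
      simp only [LinearMap.comp_apply, mul_ι_ι, mul_ι_pre, mul_assoc]
  have smul_mul_ι (a b : A) (u : S) : mul (mul (ι a) u) (ι b) = mul (ι (a * b)) u := by
    refine LinearMap.congr_fun (f := mul.flip (ι b) ∘ₗ mul (ι a)) (LinearMap.ext_on hspan ?_) u
    rintro _ (⟨c, rfl⟩ | ⟨c, p, rfl⟩) <;>
      simp only [LinearMap.comp_apply, LinearMap.flip_apply, mul_ι_ι, mul_ι_pre, mul_pre_ι,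
        mul_right_comm]
  have smul_mul_pre (a b : A) (u v : S) :
      mul (mul (ι a) u) (pre b v) = mul (ι (a * b)) (mul u (pre 1 v)) := by
    rw [← smul_mul_smul, mul_ι_pre, mul_one]
  have pre_mul_smul (a b : A) (u v : S) :
      mul (pre a u) (mul (ι b) v) = mul (ι (a * b)) (mul (pre 1 u) v) := by
    rw [← smul_mul_smul, mul_ι_pre, mul_one]
  refine LinearMap.ext_on₂ (f := mul.compr₂ D)
    (g := mul.comp D + mul.compl₂ D + lam • mul.compl₁₂ D D) hspan ?_ x y
  rintro _ (⟨a, rfl⟩ | ⟨a, u, rfl⟩) _ (⟨b, rfl⟩ | ⟨b, v, rfl⟩) <;>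
    simp only [LinearMap.compl₁₂_apply, LinearMap.compr₂_apply, LinearMap.compl₂_apply,
      LinearMap.comp_apply, LinearMap.add_apply, LinearMap.smul_apply, D_ι, D_pre, mul_ι_ι,
      mul_ι_pre, mul_pre_ι, mul_pre_pre, hd, map_add, map_smul, smul_mul_smul, ι_mul_smul,
      smul_mul_ι, smul_mul_pre, pre_mul_smul] <;>
    module

end MixableShuffle

/-- For a `λ`-derivation `d` on `A`, the operator `d̄` defined on the mixable
shuffle algebra `Ш(A)` (presented abstractly via the hypotheses below) by
`d̄(x₀) = d x₀` and
`d̄(x₀⊗x₁⊗⋯⊗xₙ) = d(x₀)⊗x₁⊗⋯⊗xₙ + (x₀x₁)⊗x₂⊗⋯⊗xₙ + λ (d(x₀)x₁)⊗x₂⊗⋯⊗xₙ`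
is a `λ`-derivation on `(Ш(A), ⋄)`, and `(Ш(A), d̄, P_A)` with
`P_A = pre 1` is a differential Rota–Baxter algebra of weight `λ`. -/
theorem mixable_shuffle_differential_rota_baxter {k A S : Type*} [CommRing k]
    [CommRing A] [Algebra k A] [AddCommGroup S] [Module k S] (lam : k)
    (t : ∀ n : ℕ, MultilinearMap k (fun _ : Fin (n + 1) => A) S)
    (pre : A →ₗ[k] S →ₗ[k] S)
    (hpre : ∀ (a : A) (n : ℕ) (x : Fin (n + 1) → A),
      pre a (t n x) = t (n + 1) (Fin.cons a x))
    (hspan : Submodule.span k {s : S | ∃ n x, s = t n x} = ⊤)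
    (mul : S →ₗ[k] S →ₗ[k] S)
    (h0l : ∀ (a : A) (n : ℕ) (b : Fin (n + 1) → A),
      mul (t 0 fun _ => a) (t n b) = t n (Function.update b 0 (a * b 0)))
    (h0r : ∀ (n : ℕ) (a : Fin (n + 1) → A) (b : A),
      mul (t n a) (t 0 fun _ => b) = t n (Function.update a 0 (a 0 * b)))
    (hrec : ∀ (m n : ℕ) (a : Fin (m + 2) → A) (b : Fin (n + 2) → A),
      mul (t (m + 1) a) (t (n + 1) b) =
        pre (a 0 * b 0)
          (mul (t m (Fin.tail a)) (t (n + 1) (Fin.cons 1 (Fin.tail b)))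
            + mul (t (m + 1) (Fin.cons 1 (Fin.tail a))) (t n (Fin.tail b))
            + lam • mul (t m (Fin.tail a)) (t n (Fin.tail b))))
    (d : A →ₗ[k] A)
    (hd : ∀ x y : A, d (x * y) = d x * y + x * d y + lam • (d x * d y))
    (hd1 : d 1 = 0)
    (dbar : S →ₗ[k] S)
    (hdbar0 : ∀ a : A, dbar (t 0 fun _ => a) = t 0 fun _ => d a)
    (hdbarS : ∀ (n : ℕ) (x : Fin (n + 2) → A),
      dbar (t (n + 1) x) =
        t (n + 1) (Function.update x 0 (d (x 0)))
          + t n (Fin.cons (x 0 * x 1) fun i => x i.succ.succ)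
          + lam • t n (Fin.cons (d (x 0) * x 1) fun i => x i.succ.succ)) :
    (∀ x y : S,
      dbar (mul x y) =
        mul (dbar x) y + mul x (dbar y) + lam • mul (dbar x) (dbar y)) ∧
    dbar (t 0 fun _ => (1 : A)) = 0 ∧
    (∀ x y : S,
      mul (pre 1 x) (pre 1 y) =
        pre 1 (mul x (pre 1 y)) + pre 1 (mul y (pre 1 x))
          + lam • pre 1 (mul x y)) ∧
    (∀ x : S, dbar (pre 1 x) = x) := by
  let ι : A →ₗ[k] S := (t 0).toLinearMap (fun _ => 0) 0
  have ι_apply (a : A) : ι a = t 0 fun _ => a := by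
    refine congrArg (t 0) ?_
    rw [eq_const_of_fin_one (Function.update _ _ _), Function.update_self]
  have t_succ (n : ℕ) (x : Fin (n + 2) → A) : t (n + 1) x = pre (x 0) (t n (Fin.tail x)) := by
    rw [hpre, Fin.cons_self_tail]
  have update_zero (n : ℕ) (x : Fin (n + 1) → A) (a : A) :
      Function.update x 0 a = Fin.cons a (Fin.tail x) := by
    rw [← Fin.cons_self_tail x, Fin.update_cons_zero, Fin.tail_cons]
  have mul_ι_pre (a b : A) (u : S) : mul (ι a) (pre b u) = pre (a * b) u := by
    refine LinearMap.congr_fun (f := mul (ι a) ∘ₗ pre b) (LinearMap.ext_on hspan ?_) u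
    rintro _ ⟨n, x, rfl⟩
    rw [LinearMap.comp_apply, ι_apply, hpre, h0l, Fin.update_cons_zero, Fin.cons_zero, hpre]
  have mul_pre_ι (a b : A) (u : S) : mul (pre a u) (ι b) = pre (a * b) u := by
    refine LinearMap.congr_fun (f := mul.flip (ι b) ∘ₗ pre a) (LinearMap.ext_on hspan ?_) u
    rintro _ ⟨n, x, rfl⟩
    rw [LinearMap.comp_apply, LinearMap.flip_apply, ι_apply, hpre, h0r, Fin.update_cons_zero,
      Fin.cons_zero, hpre]
  have mul_pre_pre (a b : A) (u v : S) : mul (pre a u) (pre b v) =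
      pre (a * b) (mul u (pre 1 v) + mul (pre 1 u) v + lam • mul u v) := by
    refine LinearMap.ext_on₂ (f := mul.compl₁₂ (pre a) (pre b))
      (g := (mul.compl₂ (pre 1) + mul.comp (pre 1) + lam • mul).compr₂ (pre (a * b))) hspan ?_ u v
    rintro _ ⟨m, x, rfl⟩ _ ⟨n, y, rfl⟩
    simp only [LinearMap.compl₁₂_apply, LinearMap.compr₂_apply, LinearMap.compl₂_apply,
      LinearMap.comp_apply, LinearMap.add_apply, LinearMap.smul_apply, hpre, hrec, Fin.cons_zero,
      Fin.tail_cons]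
  have D_pre (a : A) (u : S) :
      dbar (pre a u) = pre (d a) u + mul (ι a) u + lam • mul (ι (d a)) u := by
    refine LinearMap.congr_fun (f := dbar ∘ₗ pre a)
      (g := pre (d a) + mul (ι a) + lam • mul (ι (d a))) (LinearMap.ext_on hspan ?_) u
    rintro _ ⟨n, x, rfl⟩
    simp only [LinearMap.comp_apply, LinearMap.add_apply, LinearMap.smul_apply, ι_apply, hpre,
      h0l, hdbarS, update_zero, Fin.cons_zero, Fin.tail_cons]
    rfl
  have ι_one_mul (u : S) : mul (ι 1) u = u := by
    refine LinearMap.congr_fun (f := mul (ι 1)) (g := LinearMap.id)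
      (LinearMap.ext_on hspan ?_) u
    rintro _ ⟨n, x, rfl⟩
    rw [ι_apply, h0l, one_mul, Function.update_eq_self, LinearMap.id_apply]
  have hcomm := mixable_shuffle_comm lam t pre hspan mul h0l h0r hrec
  refine ⟨?_, ?_, fun x y => ?_, fun x => ?_⟩
  · refine shuffle_lambda_derivation lam ι pre mul ?_ (fun a b => ?_) mul_ι_pre mul_pre_ι
      mul_pre_pre d hd dbar (fun a => ?_) D_pre
    · simpa only [ι_apply] using span_range_union_pre_eq_top t pre hpre hspan
    · rw [ι_apply, ι_apply, h0l, ι_apply, eq_const_of_fin_one (Function.update _ _ _),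
        Function.update_self]
    · rw [ι_apply, hdbar0, ι_apply]
  · rw [hdbar0, hd1, ← ι_apply, map_zero]
  · rw [mul_pre_pre, one_mul, hcomm y, map_add, map_add, map_smul]
  · simp only [D_pre, hd1, ι_one_mul, map_zero, LinearMap.zero_apply, smul_zero, zero_add, add_zero]
end
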